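/- In any n-dimensional semi-symmetric semi-Riemannian manifold of any signature (in particular in any 2-symmetric one), the Ricci and Riemann tensors satisfy R_{ρ(μ} R^{ρ}_{ν)αβ} = 0, R^{ρ}_{μ[αβ} R_{γ]ρ} = 0, C^{ρ}_{μ[αβ} R_{γ]ρ} = 0, and R^{ρσ} R_{ρμσν} = R_{μ}{}^{ρ} R_{ρν}, where C is the Weyl tensor. -/

import Mathlib

noncomputable section

open scoped BigOperators

/-! ## A local-coordinate framework for semi-Riemannian geometry

A semi-Riemannian manifold is described in a local chart: points are elements of
`Pt n := Fin n → ℝ`, a rank-`q` covariant tensor field is a map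
`Pt n → (Fin q → Fin n) → ℝ`, the metric `g` (with inverse `ginv`) determines the
Christoffel symbols of its Levi-Civita connection, the covariant derivative `covD`,
and the Riemann, Ricci, scalar and Weyl curvatures. -/

/-- Points of a local chart of an `n`-dimensional manifold. -/
abbrev Pt (n : ℕ) : Type := Fin n → ℝ

/-- A rank-`q` (covariant) tensor field, in the chart. -/
abbrev Tensor (n q : ℕ) : Type := Pt n → (Fin q → Fin n) → ℝ

/-- Partial derivative of a scalar field in the `i`-th coordinate direction. -/
def pd {n : ℕ} (i : Fin n) (f : Pt n → ℝ) (x : Pt n) : ℝ :=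
  fderiv ℝ f x (Pi.single i 1)

/-- `g` is a smooth metric of arbitrary signature, with (smooth) inverse `ginv`. -/
def IsMetric {n : ℕ} (g ginv : Pt n → Fin n → Fin n → ℝ) : Prop :=
  (∀ x μ ν, g x μ ν = g x ν μ) ∧
  (∀ μ ν, ContDiff ℝ (⊤ : ℕ∞) fun x => g x μ ν) ∧
  (∀ μ ν, ContDiff ℝ (⊤ : ℕ∞) fun x => ginv x μ ν) ∧
  (∀ x μ ν, (∑ ρ, ginv x μ ρ * g x ρ ν) = if μ = ν then (1 : ℝ) else 0)

/-- The metric `g` has Lorentzian signature `(-,+,…,+)`: at every point there is a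
frame in which it takes the form `diag (-1, 1, …, 1)`. -/
def IsLorentzian {n : ℕ} (g : Pt n → Fin n → Fin n → ℝ) : Prop :=
  ∀ x, ∃ e : Fin n → Fin n → ℝ, ∀ μ ν : Fin n,
    (∑ α, ∑ β, g x α β * e μ α * e ν β) =
      if μ = ν then (if μ.val = 0 then (-1 : ℝ) else 1) else 0

/-- Christoffel symbols `Γ^α_{βγ}` of the Levi-Civita connection of `g`. -/
def christoffel {n : ℕ} (g ginv : Pt n → Fin n → Fin n → ℝ) (x : Pt n) (α β γ : Fin n) : ℝ :=
  (1 / 2) * ∑ ρ, ginv x α ρ *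
    (pd β (fun y => g y ρ γ) x + pd γ (fun y => g y ρ β) x - pd ρ (fun y => g y β γ) x)

/-- Covariant derivative of a rank-`q` covariant tensor field:
`(covD T)_{λ α₁ … α_q} = ∇_λ T_{α₁ … α_q}`; the derivative index comes first. -/
def covD {n q : ℕ} (g ginv : Pt n → Fin n → Fin n → ℝ) (T : Tensor n q) :
    Tensor n (q + 1) := fun x idx =>
  pd (idx 0) (fun y => T y fun i => idx i.succ) x -
    ∑ i : Fin q, ∑ ρ, christoffel g ginv x ρ (idx 0) (idx i.succ) *
      T x (Function.update (fun j => idx j.succ) i ρ)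

/-- Covariant derivative `∇_λ k^μ` of a vector field `k^μ`. -/
def covDVec {n : ℕ} (g ginv : Pt n → Fin n → Fin n → ℝ) (k : Pt n → Fin n → ℝ)
    (x : Pt n) (lam μ : Fin n) : ℝ :=
  pd lam (fun y => k y μ) x + ∑ ρ, christoffel g ginv x μ lam ρ * k x ρ

/-- Riemann curvature tensor `R^α_{βγδ}` of the Levi-Civita connection of `g`. -/
def riemannUp {n : ℕ} (g ginv : Pt n → Fin n → Fin n → ℝ) (x : Pt n) (α β γ δ : Fin n) : ℝ :=
  pd γ (fun y => christoffel g ginv y α δ β) x - pd δ (fun y => christoffel g ginv y α γ β) x +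
    ∑ ρ, (christoffel g ginv x α γ ρ * christoffel g ginv x ρ δ β -
          christoffel g ginv x α δ ρ * christoffel g ginv x ρ γ β)

/-- Fully covariant Riemann tensor `R_{αβγδ} = g_{αρ} R^ρ_{βγδ}`. -/
def riemann {n : ℕ} (g ginv : Pt n → Fin n → Fin n → ℝ) : Tensor n 4 := fun x idx =>
  ∑ ρ, g x (idx 0) ρ * riemannUp g ginv x ρ (idx 1) (idx 2) (idx 3)

/-- Ricci tensor `R_{μν} = R^ρ_{μρν}`. -/
def ricci {n : ℕ} (g ginv : Pt n → Fin n → Fin n → ℝ) : Tensor n 2 := fun x idx =>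
  ∑ ρ, riemannUp g ginv x ρ (idx 0) ρ (idx 1)

/-- Scalar curvature `R = g^{μν} R_{μν}`. -/
def scalarCurv {n : ℕ} (g ginv : Pt n → Fin n → Fin n → ℝ) (x : Pt n) : ℝ :=
  ∑ μ, ∑ ν, ginv x μ ν * ricci g ginv x ![μ, ν]

/-- Weyl conformal tensor `C_{αβλμ}`, defined through the standard decomposition
`R_{αβλμ} = C_{αβλμ} + (2/(n-2)) (R_{α[λ} g_{μ]β} - R_{β[λ} g_{μ]α})
 - (R/((n-1)(n-2))) (g_{αλ} g_{βμ} - g_{αμ} g_{βλ})`. -/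
def weyl {n : ℕ} (g ginv : Pt n → Fin n → Fin n → ℝ) : Tensor n 4 := fun x idx =>
  riemann g ginv x idx -
    (2 / ((n : ℝ) - 2)) *
      ((ricci g ginv x ![idx 0, idx 2] * g x (idx 3) (idx 1) -
        ricci g ginv x ![idx 0, idx 3] * g x (idx 2) (idx 1)) / 2 -
       (ricci g ginv x ![idx 1, idx 2] * g x (idx 3) (idx 0) -
        ricci g ginv x ![idx 1, idx 3] * g x (idx 2) (idx 0)) / 2) +
    (scalarCurv g ginv x / (((n : ℝ) - 1) * ((n : ℝ) - 2))) *
      (g x (idx 0) (idx 2) * g x (idx 1) (idx 3) - g x (idx 0) (idx 3) * g x (idx 1) (idx 2))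

/-- Second-order symmetry (2-symmetry): `∇_μ ∇_ν R_{αβγδ} = 0` everywhere. -/
def TwoSymmetric {n : ℕ} (g ginv : Pt n → Fin n → Fin n → ℝ) : Prop :=
  ∀ x idx, covD g ginv (covD g ginv (riemann g ginv)) x idx = 0

/-- 2-symmetry on a set `D`: `∇_μ ∇_ν R_{αβγδ} = 0` on `D`. -/
def TwoSymmetricOn {n : ℕ} (g ginv : Pt n → Fin n → Fin n → ℝ) (D : Set (Pt n)) : Prop :=
  ∀ x ∈ D, ∀ idx, covD g ginv (covD g ginv (riemann g ginv)) x idx = 0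

/-- Semi-symmetry: `∇_[μ ∇_ν] R_{αβγδ} = 0` everywhere. -/
def SemiSymmetric {n : ℕ} (g ginv : Pt n → Fin n → Fin n → ℝ) : Prop :=
  ∀ x (μ ν α β γ δ : Fin n),
    covD g ginv (covD g ginv (riemann g ginv)) x ![μ, ν, α, β, γ, δ] =
    covD g ginv (covD g ginv (riemann g ginv)) x ![ν, μ, α, β, γ, δ]

/-- `p` is a generic point: the Riemann tensor at `p`, viewed as the endomorphism
`ω_{γδ} ↦ R^{αβ}_{γδ} ω_{γδ}` of the space of 2-forms at `p`, is non-singular. -/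
def GenericAt {n : ℕ} (g ginv : Pt n → Fin n → Fin n → ℝ) (p : Pt n) : Prop :=
  ∀ ω : Fin n → Fin n → ℝ, (∀ γ δ, ω γ δ = -ω δ γ) →
    (∀ α β, (∑ γ, ∑ δ, (∑ σ, ginv p β σ * riemannUp g ginv p α σ γ δ) * ω γ δ) = 0) →
    ω = 0

/-- `k` is a parallel null (nowhere zero) vector field on `D`. -/
def ParallelNullVectorFieldOn {n : ℕ} (g ginv : Pt n → Fin n → Fin n → ℝ)
    (D : Set (Pt n)) (k : Pt n → Fin n → ℝ) : Prop :=
  (∀ x ∈ D, ∀ lam μ, covDVec g ginv k x lam μ = 0) ∧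
  (∀ x ∈ D, (∑ μ, ∑ ν, g x μ ν * k x μ * k x ν) = 0) ∧
  (∀ x ∈ D, k x ≠ 0)

/-- Pullback metric of `g` along a coordinate change `φ`. -/
def pullback {n : ℕ} (g : Pt n → Fin n → Fin n → ℝ) (φ : Pt n → Pt n)
    (x : Pt n) (μ ν : Fin n) : ℝ :=
  ∑ α, ∑ β, g (φ x) α β * pd μ (fun y => φ y α) x * pd ν (fun y => φ y β) x

/-- `k`-th iterated covariant derivative of a rank-`q` tensor field. -/
def covDIter {n : ℕ} (g ginv : Pt n → Fin n → Fin n → ℝ) (q : ℕ) :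
    (k : ℕ) → Tensor n q → Tensor n (q + k)
  | 0, T => T
  | k + 1, T => covD g ginv (covDIter g ginv q k T)

/-- Totally antisymmetric Levi-Civita symbol. -/
def lcSymbol {n : ℕ} (idx : Fin n → Fin n) : ℝ :=
  if h : Function.Bijective idx then ((Equiv.Perm.sign (Equiv.ofBijective idx h) : ℤ) : ℝ) else 0

/-- The metric volume element `n`-form `√|det g| ε_{μ₁…μ_n}`. -/
def volForm {n : ℕ} (g : Pt n → Fin n → Fin n → ℝ) : Tensor n n := fun x idx =>
  Real.sqrt |Matrix.det (Matrix.of (g x))| * lcSymbol idx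

/-- Formal curvature invariants of rank `q`: tensor fields constructed polynomially
from the metric, its inverse, the Riemann tensor, the volume `n`-form, covariant
derivatives, tensor products, (metric) contractions, index permutations, sums and
scalar multiples. -/
inductive TExpr (n : ℕ) : ℕ → Type where
  | metric : TExpr n 2
  | inv : TExpr n 2
  | riem : TExpr n 4
  | eps : TExpr n n
  | cd : {q : ℕ} → TExpr n q → TExpr n (q + 1)
  | tprod : {q r : ℕ} → TExpr n q → TExpr n r → TExpr n (q + r)
  | contr : {q : ℕ} → TExpr n (q + 2) → TExpr n q
  | permute : {q : ℕ} → Equiv.Perm (Fin q) → TExpr n q → TExpr n q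
  | add : {q : ℕ} → TExpr n q → TExpr n q → TExpr n q
  | smul : {q : ℕ} → ℝ → TExpr n q → TExpr n q

/-- Evaluation of a formal curvature invariant as a tensor field. -/
def TExpr.eval {n : ℕ} (g ginv : Pt n → Fin n → Fin n → ℝ) :
    {q : ℕ} → TExpr n q → Tensor n q
  | _, .metric => fun x idx => g x (idx 0) (idx 1)
  | _, .inv => fun x idx => ginv x (idx 0) (idx 1)
  | _, .riem => riemann g ginv
  | _, .eps => volForm g
  | _, .cd e => covD g ginv (TExpr.eval g ginv e)
  | _, .tprod e₁ e₂ => fun x idx =>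
      TExpr.eval g ginv e₁ x (fun i => idx (Fin.castAdd _ i)) *
      TExpr.eval g ginv e₂ x (fun i => idx (Fin.natAdd _ i))
  | _, .contr e => fun x idx =>
      ∑ ρ, ∑ σ, ginv x ρ σ * TExpr.eval g ginv e x (Fin.cons ρ (Fin.cons σ idx))
  | _, .permute π e => fun x idx => TExpr.eval g ginv e x (idx ∘ π)
  | _, .add e₁ e₂ => fun x idx => TExpr.eval g ginv e₁ x idx + TExpr.eval g ginv e₂ x idx
  | _, .smul c e => fun x idx => c * TExpr.eval g ginv e x idx

/-- `e.HasOrderDeg m d`: the invariant `e` is homogeneous of order `m` (number of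
covariant derivatives in each term) and degree `d` (number of Riemann factors in
each term). -/
inductive TExpr.HasOrderDeg {n : ℕ} : {q : ℕ} → TExpr n q → ℕ → ℕ → Prop where
  | metric : HasOrderDeg .metric 0 0
  | inv : HasOrderDeg .inv 0 0
  | riem : HasOrderDeg .riem 0 1
  | eps : HasOrderDeg .eps 0 0
  | cd {q : ℕ} {e : TExpr n q} {m d : ℕ} : HasOrderDeg e m d → HasOrderDeg e.cd (m + 1) d
  | tprod {q r : ℕ} {e₁ : TExpr n q} {e₂ : TExpr n r} {m₁ d₁ m₂ d₂ : ℕ} :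
      HasOrderDeg e₁ m₁ d₁ → HasOrderDeg e₂ m₂ d₂ →
      HasOrderDeg (e₁.tprod e₂) (m₁ + m₂) (d₁ + d₂)
  | contr {q : ℕ} {e : TExpr n (q + 2)} {m d : ℕ} : HasOrderDeg e m d → HasOrderDeg e.contr m d
  | permute {q : ℕ} {π : Equiv.Perm (Fin q)} {e : TExpr n q} {m d : ℕ} :
      HasOrderDeg e m d → HasOrderDeg (e.permute π) m d
  | add {q : ℕ} {e₁ e₂ : TExpr n q} {m d : ℕ} :
      HasOrderDeg e₁ m d → HasOrderDeg e₂ m d → HasOrderDeg (e₁.add e₂) m d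
  | smul {q : ℕ} {c : ℝ} {e : TExpr n q} {m d : ℕ} :
      HasOrderDeg e m d → HasOrderDeg (e.smul c) m d

/-- `P` is the parallel-transport operator along the curve `γ`. -/
def IsTransportAlong {n : ℕ} (g ginv : Pt n → Fin n → Fin n → ℝ)
    (γ : ℝ → Pt n) (P : ℝ → Fin n → Fin n → ℝ) : Prop :=
  (∀ μ ν, P 0 μ ν = if μ = ν then (1 : ℝ) else 0) ∧
  ∀ t μ ν, HasDerivAt (fun s => P s μ ν)
    (-∑ lam, ∑ ρ, christoffel g ginv (γ t) μ lam ρ * deriv (fun s => γ s lam) t * P t ρ ν) t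

/-- The subspace `W` of the tangent space at `p` is invariant under the holonomy
group of `(D, g)` at `p` (parallel transport around smooth loops in `D` based at `p`). -/
def HolonomyInvariantAt {n : ℕ} (g ginv : Pt n → Fin n → Fin n → ℝ) (D : Set (Pt n))
    (p : Pt n) (W : Submodule ℝ (Fin n → ℝ)) : Prop :=
  ∀ γ : ℝ → Pt n, ContDiff ℝ (⊤ : ℕ∞) γ → (∀ t, γ t ∈ D) → γ 0 = p → γ 1 = p →
    ∀ P, IsTransportAlong g ginv γ P →
      ∀ w ∈ W, (fun μ => ∑ ν, P 1 μ ν * w ν) ∈ W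

/-- The holonomy group of `(D,g)` at `p` is reducible: it leaves invariant a
non-trivial subspace of the tangent space. -/
def ReducibleAt {n : ℕ} (g ginv : Pt n → Fin n → Fin n → ℝ) (D : Set (Pt n))
    (p : Pt n) : Prop :=
  ∃ W : Submodule ℝ (Fin n → ℝ), W ≠ ⊥ ∧ W ≠ ⊤ ∧ HolonomyInvariantAt g ginv D p W

/-- The holonomy group of `(D,g)` at `p` is non-degenerately reducible: it leaves
invariant a non-trivial subspace on which `g` is non-degenerate. -/
def NonDegReducibleAt {n : ℕ} (g ginv : Pt n → Fin n → Fin n → ℝ) (D : Set (Pt n))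
    (p : Pt n) : Prop :=
  ∃ W : Submodule ℝ (Fin n → ℝ), W ≠ ⊥ ∧ W ≠ ⊤ ∧ HolonomyInvariantAt g ginv D p W ∧
    ∀ w ∈ W, (∀ u ∈ W, (∑ μ, ∑ ν, g p μ ν * w μ * u ν) = 0) → w = 0


/-- `R^ρ_{μαβ} R_{γρ}`, an auxiliary contraction of Riemann with Ricci. -/
def auxRR {n : ℕ} (g ginv : Pt n → Fin n → Fin n → ℝ) (x : Pt n) (μ α β γ : Fin n) : ℝ :=
  ∑ ρ, riemannUp g ginv x ρ μ α β * ricci g ginv x ![γ, ρ]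

/-- `C^ρ_{μαβ} R_{γρ}`, an auxiliary contraction of Weyl with Ricci. -/
def auxCR {n : ℕ} (g ginv : Pt n → Fin n → Fin n → ℝ) (x : Pt n) (μ α β γ : Fin n) : ℝ :=
  ∑ ρ, (∑ σ, ginv x ρ σ * weyl g ginv x ![σ, μ, α, β]) * ricci g ginv x ![γ, ρ]

section PartialDerivatives

variable {n : ℕ}

theorem pd_sub {f h : Pt n → ℝ} (hf : ContDiff ℝ (⊤ : ℕ∞) f) (hh : ContDiff ℝ (⊤ : ℕ∞) h)
    (i : Fin n) (x : Pt n) : pd i (fun y => f y - h y) x = pd i f x - pd i h x := by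
  unfold pd
  rw [fderiv_fun_sub (hf.differentiable (by simp) x) (hh.differentiable (by simp) x)]
  rfl

theorem pd_mul {f h : Pt n → ℝ} (hf : ContDiff ℝ (⊤ : ℕ∞) f) (hh : ContDiff ℝ (⊤ : ℕ∞) h)
    (i : Fin n) (x : Pt n) :
    pd i (fun y => f y * h y) x = pd i f x * h x + f x * pd i h x := by
  unfold pd
  rw [fderiv_fun_mul (hf.differentiable (by simp) x) (hh.differentiable (by simp) x)]
  simp
  ring

theorem pd_sum {ι : Type*} {s : Finset ι} {f : ι → Pt n → ℝ}
    (hf : ∀ j, ContDiff ℝ (⊤ : ℕ∞) (f j)) (i : Fin n) (x : Pt n) :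
    pd i (fun y => ∑ j ∈ s, f j y) x = ∑ j ∈ s, pd i (f j) x := by
  unfold pd
  rw [fderiv_fun_sum fun j _ => (hf j).differentiable (by simp) x]
  simp

theorem contDiff_pd {f : Pt n → ℝ} (hf : ContDiff ℝ (⊤ : ℕ∞) f) (i : Fin n) :
    ContDiff ℝ (⊤ : ℕ∞) (pd i f) :=
  (hf.fderiv_right (m := (⊤ : ℕ∞)) (by simp)).clm_apply contDiff_const

/-- Partial derivatives of smooth functions commute. -/
theorem pd_comm {f : Pt n → ℝ} (hf : ContDiff ℝ (⊤ : ℕ∞) f) (i j : Fin n) (x : Pt n) :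
    pd i (pd j f) x = pd j (pd i f) x := by
  have hd : DifferentiableAt ℝ (fderiv ℝ f) x :=
    (hf.fderiv_right (m := (⊤ : ℕ∞)) (by simp)).differentiable (by simp) x
  have key : ∀ i j : Fin n, pd i (pd j f) x =
      fderiv ℝ (fderiv ℝ f) x (Pi.single i 1) (Pi.single j 1) := by
    intro i j
    unfold pd
    rw [fderiv_clm_apply hd (differentiableAt_const _)]
    simp
  rw [key, key]
  exact hf.contDiffAt.isSymmSndFDerivAt
    (by simpa using ENat.LEInfty.out) _ _

end PartialDerivatives

section Connection

variable {n : ℕ} {g ginv : Pt n → Fin n → Fin n → ℝ}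

theorem IsMetric.contDiff_christoffel (hg : IsMetric g ginv) (α β γ : Fin n) :
    ContDiff ℝ (⊤ : ℕ∞) fun x => christoffel g ginv x α β γ := by
  obtain ⟨-, h1, h2, -⟩ := hg
  unfold christoffel
  refine contDiff_const.mul (ContDiff.sum fun ρ _ => (h2 _ _).mul ?_)
  exact ((contDiff_pd (h1 _ _) _).add (contDiff_pd (h1 _ _) _)).sub (contDiff_pd (h1 _ _) _)

/-- The Levi-Civita connection is torsion free. -/
theorem IsMetric.christoffel_comm (hg : IsMetric g ginv) (x : Pt n) (α β γ : Fin n) :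
    christoffel g ginv x α β γ = christoffel g ginv x α γ β := by
  unfold christoffel
  congr 1
  refine Finset.sum_congr rfl fun ρ _ => ?_
  rw [show pd ρ (fun y => g y β γ) x = pd ρ (fun y => g y γ β) x from
    congrArg (fun f => pd ρ f x) (funext fun y => hg.1 y β γ)]
  ring

theorem IsMetric.inv_mul_metric_eq_one (hg : IsMetric g ginv) (x : Pt n) :
    Matrix.of (ginv x) * Matrix.of (g x) = 1 := by
  ext i j
  simpa [Matrix.mul_apply, Matrix.one_apply] using hg.2.2.2 x i j

theorem IsMetric.metric_mul_inv (hg : IsMetric g ginv) (x : Pt n) (μ ν : Fin n) :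
    (∑ ρ, g x μ ρ * ginv x ρ ν) = if μ = ν then (1 : ℝ) else 0 := by
  have h : Matrix.of (g x) * Matrix.of (ginv x) = 1 :=
    mul_eq_one_comm.mp (hg.inv_mul_metric_eq_one x)
  simpa [Matrix.mul_apply, Matrix.one_apply] using congrFun (congrFun h μ) ν

theorem IsMetric.inv_symm (hg : IsMetric g ginv) (x : Pt n) (μ ν : Fin n) :
    ginv x μ ν = ginv x ν μ := by
  have hs : (Matrix.of (g x)).IsSymm := Matrix.IsSymm.ext fun i j => hg.1 x j i
  have hi : Matrix.of (ginv x) = (Matrix.of (g x))⁻¹ :=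
    (Matrix.inv_eq_left_inv (hg.inv_mul_metric_eq_one x)).symm
  have ht : (Matrix.of (ginv x)).transpose = Matrix.of (ginv x) := by
    rw [hi, Matrix.transpose_nonsing_inv, hs.eq]
  exact congrFun (congrFun ht ν) μ

theorem IsMetric.sum_metric_mul_christoffel (hg : IsMetric g ginv) (x : Pt n)
    (α β γ : Fin n) :
    ∑ ρ, g x α ρ * christoffel g ginv x ρ β γ =
      (1 / 2) * (pd β (fun y => g y α γ) x + pd γ (fun y => g y α β) x -
        pd α (fun y => g y β γ) x) := by
  unfold christoffel
  simp_rw [Finset.mul_sum]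
  rw [Finset.sum_comm]
  have h : ∀ σ, ∑ ρ, g x α ρ * ((1 / 2) * (ginv x ρ σ *
      (pd β (fun y => g y σ γ) x + pd γ (fun y => g y σ β) x - pd σ (fun y => g y β γ) x))) =
      if α = σ then (1 / 2) * (pd β (fun y => g y σ γ) x + pd γ (fun y => g y σ β) x -
        pd σ (fun y => g y β γ) x) else 0 := by
    intro σ
    rw [← one_mul ((1 / 2 : ℝ) * _), ← ite_zero_mul, ← hg.metric_mul_inv, Finset.sum_mul]
    exact Finset.sum_congr rfl fun ρ _ => by ring
  simp only [h, Finset.sum_ite_eq, Finset.mem_univ, if_true]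

/-- The connection is metric. -/
theorem IsMetric.covD_metric (hg : IsMetric g ginv) :
    covD g ginv (fun x (idx : Fin 2 → Fin n) => g x (idx 0) (idx 1)) = 0 := by
  funext x idx
  have hs : ∀ i a b, pd i (fun y => g y a b) x = pd i (fun y => g y b a) x := fun i a b =>
    congrArg (fun f => pd i f x) (funext fun y => hg.1 y a b)
  have h1 := hg.sum_metric_mul_christoffel x (idx 1) (idx 0) (idx 2)
  have h2 := hg.sum_metric_mul_christoffel x (idx 2) (idx 0) (idx 1)
  have e2 : ∑ ρ, christoffel g ginv x ρ (idx 0) (idx 1) * g x ρ (idx 2) =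
      ∑ ρ, g x (idx 2) ρ * christoffel g ginv x ρ (idx 0) (idx 1) :=
    Finset.sum_congr rfl fun ρ _ => by rw [hg.1 x ρ, mul_comm]
  have e1 : ∑ ρ, christoffel g ginv x ρ (idx 0) (idx 2) * g x (idx 1) ρ =
      ∑ ρ, g x (idx 1) ρ * christoffel g ginv x ρ (idx 0) (idx 2) :=
    Finset.sum_congr rfl fun ρ _ => by rw [mul_comm]
  have hc : covD g ginv (fun x (idx : Fin 2 → Fin n) => g x (idx 0) (idx 1)) x idx =
      pd (idx 0) (fun y => g y (idx 1) (idx 2)) x -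
        (∑ ρ, christoffel g ginv x ρ (idx 0) (idx 1) * g x ρ (idx 2) +
          ∑ ρ, christoffel g ginv x ρ (idx 0) (idx 2) * g x (idx 1) ρ) := by
    simp [covD, Fin.sum_univ_two]
  rw [hc, e1, e2, h1, h2, hs (idx 0) (idx 2), hs (idx 1) (idx 2), hs (idx 1) (idx 0),
    hs (idx 2) (idx 1)]
  simp only [Pi.zero_apply]
  ring

theorem IsMetric.contDiff_riemannUp (hg : IsMetric g ginv) (α β γ δ : Fin n) :
    ContDiff ℝ (⊤ : ℕ∞) fun x => riemannUp g ginv x α β γ δ := by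
  have h := hg.contDiff_christoffel
  unfold riemannUp
  exact ((contDiff_pd (h _ _ _) _).sub (contDiff_pd (h _ _ _) _)).add
    (ContDiff.sum fun ρ _ => ((h _ _ _).mul (h _ _ _)).sub ((h _ _ _).mul (h _ _ _)))

theorem IsMetric.contDiff_riemann (hg : IsMetric g ginv) (idx : Fin 4 → Fin n) :
    ContDiff ℝ (⊤ : ℕ∞) fun x => riemann g ginv x idx := by
  unfold riemann
  exact ContDiff.sum fun ρ _ => (hg.2.1 _ _).mul (hg.contDiff_riemannUp _ _ _ _)

theorem covD_cons {q : ℕ} (T : Tensor n q) (x : Pt n) (μ : Fin n) (a : Fin q → Fin n) :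
    covD g ginv T x (Fin.cons μ a) = pd μ (fun y => T y a) x -
      ∑ i, ∑ ρ, christoffel g ginv x ρ μ (a i) * T x (Function.update a i ρ) := by
  simp [covD]

theorem IsMetric.covD_covD_cons (hg : IsMetric g ginv) {q : ℕ} {T : Tensor n q}
    (hT : ∀ a, ContDiff ℝ (⊤ : ℕ∞) fun x => T x a) (x : Pt n) (μ ν : Fin n)
    (a : Fin q → Fin n) :
    covD g ginv (covD g ginv T) x (Fin.cons μ (Fin.cons ν a)) =
      pd μ (pd ν fun y => T y a) x -
      (∑ i, ∑ ρ, pd μ (fun y => christoffel g ginv y ρ ν (a i)) x *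
        T x (Function.update a i ρ)) -
      (∑ i, ∑ ρ, christoffel g ginv x ρ ν (a i) *
        pd μ (fun y => T y (Function.update a i ρ)) x) -
      (∑ ρ, christoffel g ginv x ρ μ ν * covD g ginv T x (Fin.cons ρ a)) -
      (∑ i, ∑ ρ, christoffel g ginv x ρ μ (a i) *
        pd ν (fun y => T y (Function.update a i ρ)) x) +
      ∑ i, ∑ j, ∑ ρ, ∑ σ, christoffel g ginv x ρ μ (a i) *
        christoffel g ginv x σ ν (Function.update a i ρ j) *
        T x (Function.update (Function.update a i ρ) j σ) := by
  have hΓ := hg.contDiff_christoffel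
  rw [covD_cons, Fin.sum_univ_succ]
  simp only [Fin.cons_zero, Fin.cons_succ, Fin.update_cons_zero, ← Fin.cons_update]
  simp only [covD_cons T _ ν]
  rw [pd_sub (contDiff_pd (hT a) ν) (ContDiff.sum fun i _ => ContDiff.sum fun ρ _ =>
      (hΓ _ _ _).mul (hT _)),
    pd_sum (fun i => ContDiff.sum fun ρ _ => (hΓ _ _ _).mul (hT _))]
  simp only [pd_sum (fun ρ => (hΓ ρ ν _).mul (hT _)), pd_mul (hΓ _ _ _) (hT _),
    Finset.sum_add_distrib, mul_sub, Finset.sum_sub_distrib]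
  have h : ∀ i, ∑ j, ∑ ρ, ∑ σ, christoffel g ginv x ρ μ (a i) *
        christoffel g ginv x σ ν (Function.update a i ρ j) *
        T x (Function.update (Function.update a i ρ) j σ) =
      ∑ ρ, christoffel g ginv x ρ μ (a i) * ∑ j, ∑ σ,
        christoffel g ginv x σ ν (Function.update a i ρ j) *
        T x (Function.update (Function.update a i ρ) j σ) := by
    intro i
    rw [Finset.sum_comm]
    simp only [Finset.mul_sum, mul_assoc]
  simp only [h]
  ring

/-- The quadratic connection terms of a second covariant derivative are, up to a symmetric
part, those of the curvature tensor. -/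
theorem sum_update_update_sub {q : ℕ} (A B : Fin n → Fin n → ℝ)
    (T : (Fin q → Fin n) → ℝ) (a : Fin q → Fin n) :
    (∑ i, ∑ j, ∑ ρ, ∑ σ, A ρ (a i) * B σ (Function.update a i ρ j) *
        T (Function.update (Function.update a i ρ) j σ)) -
      (∑ i, ∑ j, ∑ ρ, ∑ σ, B ρ (a i) * A σ (Function.update a i ρ j) *
        T (Function.update (Function.update a i ρ) j σ)) =
      ∑ i, ∑ ρ, (∑ σ, (A σ (a i) * B ρ σ - B σ (a i) * A ρ σ)) *
        T (Function.update a i ρ) := by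
  have hswap : (∑ i, ∑ j, ∑ ρ, ∑ σ, B ρ (a i) * A σ (Function.update a i ρ j) *
        T (Function.update (Function.update a i ρ) j σ)) =
      ∑ i, ∑ j, ∑ ρ, ∑ σ, B σ (a j) * A ρ (Function.update a j σ i) *
        T (Function.update (Function.update a j σ) i ρ) := by
    rw [Finset.sum_comm]
    exact Finset.sum_congr rfl fun i _ => Finset.sum_congr rfl fun j _ => Finset.sum_comm
  rw [hswap]
  simp only [← Finset.sum_sub_distrib]
  refine Finset.sum_congr rfl fun i _ => ?_
  rw [Finset.sum_eq_single i]
  · simp only [Function.update_self, Function.update_idem, Finset.sum_sub_distrib, sub_mul,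
      Finset.sum_mul]
    congr 1
    exact Finset.sum_comm
  · intro j _ hj
    refine Finset.sum_eq_zero fun ρ _ => Finset.sum_eq_zero fun σ _ => ?_
    rw [Function.update_of_ne hj, Function.update_of_ne hj.symm, Function.update_comm hj]
    ring
  · simp

/-- The Ricci identity for covariant tensor fields. -/
theorem IsMetric.ricci_identity (hg : IsMetric g ginv) {q : ℕ} {T : Tensor n q}
    (hT : ∀ a, ContDiff ℝ (⊤ : ℕ∞) fun x => T x a) (x : Pt n) (μ ν : Fin n)
    (a : Fin q → Fin n) :
    covD g ginv (covD g ginv T) x (Fin.cons μ (Fin.cons ν a)) -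
      covD g ginv (covD g ginv T) x (Fin.cons ν (Fin.cons μ a)) =
      -∑ i, ∑ ρ, riemannUp g ginv x ρ (a i) μ ν * T x (Function.update a i ρ) := by
  rw [hg.covD_covD_cons hT, hg.covD_covD_cons hT, pd_comm (hT a) μ ν]
  have hsym : ∑ ρ, christoffel g ginv x ρ μ ν * covD g ginv T x (Fin.cons ρ a) =
      ∑ ρ, christoffel g ginv x ρ ν μ * covD g ginv T x (Fin.cons ρ a) :=
    Finset.sum_congr rfl fun ρ _ => by rw [hg.christoffel_comm]
  have hq := sum_update_update_sub (fun ρ β => christoffel g ginv x ρ μ β)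
    (fun ρ β => christoffel g ginv x ρ ν β) (T x) a
  have hR : ∑ i, ∑ ρ, riemannUp g ginv x ρ (a i) μ ν * T x (Function.update a i ρ) =
      (∑ i, ∑ ρ, pd μ (fun y => christoffel g ginv y ρ ν (a i)) x *
        T x (Function.update a i ρ)) -
      (∑ i, ∑ ρ, pd ν (fun y => christoffel g ginv y ρ μ (a i)) x *
        T x (Function.update a i ρ)) -
      ∑ i, ∑ ρ, (∑ σ, (christoffel g ginv x σ μ (a i) * christoffel g ginv x ρ ν σ -
        christoffel g ginv x σ ν (a i) * christoffel g ginv x ρ μ σ)) *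
        T x (Function.update a i ρ) := by
    simp only [← Finset.sum_sub_distrib, riemannUp, add_mul, sub_mul, Finset.sum_mul]
    refine Finset.sum_congr rfl fun i _ => Finset.sum_congr rfl fun ρ _ => ?_
    rw [sub_eq_add_neg _ (∑ σ, _ : ℝ), ← Finset.sum_neg_distrib]
    congr 1
    exact Finset.sum_congr rfl fun σ _ => by ring
  rw [hR, hsym]
  linarith

end Connection

section Curvature

variable {n : ℕ} {g ginv : Pt n → Fin n → Fin n → ℝ}

theorem riemannUp_antisymm (x : Pt n) (α β γ δ : Fin n) :
    riemannUp g ginv x α β γ δ = -riemannUp g ginv x α β δ γ := by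
  simp only [riemannUp, Finset.sum_sub_distrib]
  ring

/-- The first Bianchi identity. -/
theorem IsMetric.riemannUp_cyclic (hg : IsMetric g ginv) (x : Pt n) (α β γ δ : Fin n) :
    riemannUp g ginv x α β γ δ + riemannUp g ginv x α γ δ β +
      riemannUp g ginv x α δ β γ = 0 := by
  have hs := hg.christoffel_comm
  have hp : ∀ i a b, pd i (fun y => christoffel g ginv y α a b) x =
      pd i (fun y => christoffel g ginv y α b a) x := fun i a b =>
    congrArg (fun f => pd i f x) (funext fun y => hs y α a b)
  have hq : ∀ a b c, ∑ ρ, christoffel g ginv x α a ρ * christoffel g ginv x ρ b c =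
      ∑ ρ, christoffel g ginv x α a ρ * christoffel g ginv x ρ c b := fun a b c =>
    Finset.sum_congr rfl fun ρ _ => by rw [hs x ρ b c]
  simp only [riemannUp, Finset.sum_sub_distrib]
  rw [hp γ δ β, hp β δ γ, hp δ γ β, hq γ δ β, hq δ γ β, hq β γ δ]
  ring

theorem riemann_antisymm_right (x : Pt n) (α β γ δ : Fin n) :
    riemann g ginv x ![α, β, γ, δ] = -riemann g ginv x ![α, β, δ, γ] := by
  simp only [riemann, ← Finset.sum_neg_distrib]
  exact Finset.sum_congr rfl fun ρ _ => by
    simp [riemannUp_antisymm x ρ β γ δ]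

theorem IsMetric.riemann_cyclic (hg : IsMetric g ginv) (x : Pt n) (α β γ δ : Fin n) :
    riemann g ginv x ![α, β, γ, δ] + riemann g ginv x ![α, γ, δ, β] +
      riemann g ginv x ![α, δ, β, γ] = 0 := by
  simp only [riemann, ← Finset.sum_add_distrib]
  exact Finset.sum_eq_zero fun ρ _ => by
    simp only [Matrix.cons_val]
    linear_combination g x α ρ * hg.riemannUp_cyclic x ρ β γ δ

theorem IsMetric.riemann_antisymm_left (hg : IsMetric g ginv) (x : Pt n) (α β γ δ : Fin n) :
    riemann g ginv x ![α, β, γ, δ] = -riemann g ginv x ![β, α, γ, δ] := by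
  have h := hg.ricci_identity (T := fun x (idx : Fin 2 → Fin n) => g x (idx 0) (idx 1))
    (fun a => hg.2.1 _ _) x γ δ ![α, β]
  have h0 : covD g ginv (0 : Tensor n 3) = 0 := by
    funext y idx
    simp [covD, pd]
  rw [hg.covD_metric, h0] at h
  simp only [Pi.zero_apply, sub_zero, Fin.sum_univ_two] at h
  have e1 : ∑ ρ, riemannUp g ginv x ρ α γ δ * g x ρ β = riemann g ginv x ![β, α, γ, δ] :=
    Finset.sum_congr rfl fun ρ _ => by rw [hg.1 x ρ β, mul_comm]; rfl
  have e2 : ∑ ρ, riemannUp g ginv x ρ β γ δ * g x α ρ = riemann g ginv x ![α, β, γ, δ] :=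
    Finset.sum_congr rfl fun ρ _ => by rw [mul_comm]; rfl
  simp only [Function.update_self, ne_eq, Fin.isValue, one_ne_zero, zero_ne_one,
    not_false_eq_true, Function.update_of_ne, Matrix.cons_val_zero, Matrix.cons_val_one] at h
  rw [e1, e2] at h
  linarith

theorem IsMetric.riemann_pair_symm (hg : IsMetric g ginv) (x : Pt n) (α β γ δ : Fin n) :
    riemann g ginv x ![α, β, γ, δ] = riemann g ginv x ![γ, δ, α, β] := by
  have c := hg.riemann_cyclic x
  have l := hg.riemann_antisymm_left x
  have r := riemann_antisymm_right (g := g) (ginv := ginv) x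
  linarith [c α γ δ β, c β δ γ α, c γ α δ β, c δ β γ α, l α γ δ β, l α δ β γ, l β α γ δ,
    l β γ α δ, l β δ γ α, l γ δ α β, r β α γ δ, r γ δ α β]

theorem IsMetric.riemannUp_eq_sum (hg : IsMetric g ginv) (x : Pt n) (α β γ δ : Fin n) :
    riemannUp g ginv x α β γ δ = ∑ σ, ginv x α σ * riemann g ginv x ![σ, β, γ, δ] := by
  have h : ∀ ρ, ∑ σ, ginv x α σ * (g x σ ρ * riemannUp g ginv x ρ β γ δ) =
      if α = ρ then riemannUp g ginv x ρ β γ δ else 0 := by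
    intro ρ
    rw [← one_mul (riemannUp g ginv x ρ β γ δ), ← ite_zero_mul, ← hg.2.2.2, Finset.sum_mul]
    exact Finset.sum_congr rfl fun σ _ => by ring
  have e : ∀ σ, riemann g ginv x ![σ, β, γ, δ] =
      ∑ ρ, g x σ ρ * riemannUp g ginv x ρ β γ δ := fun σ => rfl
  simp_rw [e, Finset.mul_sum]
  rw [Finset.sum_comm]
  simp [h]

theorem IsMetric.ricci_eq_sum (hg : IsMetric g ginv) (x : Pt n) (μ ν : Fin n) :
    ricci g ginv x ![μ, ν] = ∑ ρ, ∑ σ, ginv x ρ σ * riemann g ginv x ![ρ, μ, σ, ν] := by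
  rw [Finset.sum_comm]
  refine Finset.sum_congr rfl fun σ _ => ?_
  rw [Matrix.cons_val_zero, Matrix.cons_val_one, Matrix.cons_val_zero, hg.riemannUp_eq_sum]
  exact Finset.sum_congr rfl fun ρ _ => by rw [hg.inv_symm x σ ρ]

theorem IsMetric.ricci_symm (hg : IsMetric g ginv) (x : Pt n) (μ ν : Fin n) :
    ricci g ginv x ![μ, ν] = ricci g ginv x ![ν, μ] := by
  rw [hg.ricci_eq_sum, hg.ricci_eq_sum, Finset.sum_comm]
  exact Finset.sum_congr rfl fun ρ _ => Finset.sum_congr rfl fun σ _ => by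
    rw [hg.inv_symm x σ ρ, hg.riemann_pair_symm x σ]

/-- Semi-symmetry says that the curvature operators annihilate the Riemann tensor. -/
theorem SemiSymmetric.curvature_riemann (hg : IsMetric g ginv) (hss : SemiSymmetric g ginv)
    (x : Pt n) (μ ν α β γ δ : Fin n) :
    (∑ ρ, riemannUp g ginv x ρ α μ ν * riemann g ginv x ![ρ, β, γ, δ]) +
      (∑ ρ, riemannUp g ginv x ρ β μ ν * riemann g ginv x ![α, ρ, γ, δ]) +
      (∑ ρ, riemannUp g ginv x ρ γ μ ν * riemann g ginv x ![α, β, ρ, δ]) +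
      (∑ ρ, riemannUp g ginv x ρ δ μ ν * riemann g ginv x ![α, β, γ, ρ]) = 0 := by
  have h := hg.ricci_identity hg.contDiff_riemann x μ ν ![α, β, γ, δ]
  have h' := hss x μ ν α β γ δ
  have hz : covD g ginv (covD g ginv (riemann g ginv)) x
        (Fin.cons μ (Fin.cons ν ![α, β, γ, δ])) -
      covD g ginv (covD g ginv (riemann g ginv)) x
        (Fin.cons ν (Fin.cons μ ![α, β, γ, δ])) = 0 := sub_eq_zero.mpr h'
  rw [hz, Fin.sum_univ_four] at h
  have u0 : ∀ ρ, Function.update ![α, β, γ, δ] 0 ρ = ![ρ, β, γ, δ] := fun ρ => by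
    ext i; fin_cases i <;> rfl
  have u1 : ∀ ρ, Function.update ![α, β, γ, δ] 1 ρ = ![α, ρ, γ, δ] := fun ρ => by
    ext i; fin_cases i <;> rfl
  have u2 : ∀ ρ, Function.update ![α, β, γ, δ] 2 ρ = ![α, β, ρ, δ] := fun ρ => by
    ext i; fin_cases i <;> rfl
  have u3 : ∀ ρ, Function.update ![α, β, γ, δ] 3 ρ = ![α, β, γ, ρ] := fun ρ => by
    ext i; fin_cases i <;> rfl
  simp only [u0, u1, u2, u3] at h
  exact (neg_eq_zero.mp h.symm)

/-- Raising the second index of `R^ρ_{αμν}` gives a tensor antisymmetric in its first pair. -/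
theorem IsMetric.sum_inv_mul_riemannUp_antisymm (hg : IsMetric g ginv) (x : Pt n)
    (ρ γ μ ν : Fin n) :
    ∑ α, ginv x α γ * riemannUp g ginv x ρ α μ ν =
      -∑ α, ginv x α ρ * riemannUp g ginv x γ α μ ν := by
  simp_rw [hg.riemannUp_eq_sum x, Finset.mul_sum, ← Finset.sum_neg_distrib]
  rw [Finset.sum_comm]
  refine Finset.sum_congr rfl fun σ _ => Finset.sum_congr rfl fun α _ => ?_
  rw [hg.riemann_antisymm_left x σ α, hg.inv_symm x ρ, hg.inv_symm x γ]
  ring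

/-- The curvature operators of a semi-symmetric manifold annihilate the Ricci tensor. -/
theorem SemiSymmetric.curvature_ricci (hg : IsMetric g ginv) (hss : SemiSymmetric g ginv)
    (x : Pt n) (μ ν α β : Fin n) :
    (∑ ρ, ricci g ginv x ![ρ, μ] * riemannUp g ginv x ρ ν α β) +
      (∑ ρ, ricci g ginv x ![ρ, ν] * riemannUp g ginv x ρ μ α β) = 0 := by
  have h : ∑ κ, ∑ τ, ginv x κ τ *
      ((∑ ρ, riemannUp g ginv x ρ κ α β * riemann g ginv x ![ρ, ν, τ, μ]) +
      (∑ ρ, riemannUp g ginv x ρ ν α β * riemann g ginv x ![κ, ρ, τ, μ]) +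
      (∑ ρ, riemannUp g ginv x ρ τ α β * riemann g ginv x ![κ, ν, ρ, μ]) +
      (∑ ρ, riemannUp g ginv x ρ μ α β * riemann g ginv x ![κ, ν, τ, ρ])) = 0 :=
    Finset.sum_eq_zero fun κ _ => Finset.sum_eq_zero fun τ _ => by
      rw [hss.curvature_riemann hg, mul_zero]
  simp only [mul_add, Finset.sum_add_distrib] at h
  have t1 : ∑ κ, ∑ τ, ginv x κ τ *
      (∑ ρ, riemannUp g ginv x ρ κ α β * riemann g ginv x ![ρ, ν, τ, μ]) =
      ∑ ρ, ∑ τ, (∑ κ, ginv x κ τ * riemannUp g ginv x ρ κ α β) *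
        riemann g ginv x ![ρ, ν, τ, μ] := by
    simp_rw [Finset.mul_sum, Finset.sum_mul]
    rw [Finset.sum_comm_cycle]
    refine Finset.sum_congr rfl fun ρ _ => ?_
    rw [Finset.sum_comm]
    exact Finset.sum_congr rfl fun τ _ => Finset.sum_congr rfl fun κ _ => by ring
  have t3 : ∑ κ, ∑ τ, ginv x κ τ *
      (∑ ρ, riemannUp g ginv x ρ τ α β * riemann g ginv x ![κ, ν, ρ, μ]) =
      ∑ κ, ∑ ρ, (∑ τ, ginv x τ κ * riemannUp g ginv x ρ τ α β) *
        riemann g ginv x ![κ, ν, ρ, μ] := by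
    simp_rw [Finset.mul_sum, Finset.sum_mul]
    refine Finset.sum_congr rfl fun κ _ => ?_
    rw [Finset.sum_comm]
    exact Finset.sum_congr rfl fun ρ _ => Finset.sum_congr rfl fun τ _ => by
      rw [hg.inv_symm x κ τ]; ring
  have t13 : ∑ ρ, ∑ τ, (∑ κ, ginv x κ τ * riemannUp g ginv x ρ κ α β) *
        riemann g ginv x ![ρ, ν, τ, μ] =
      -∑ κ, ∑ ρ, (∑ τ, ginv x τ κ * riemannUp g ginv x ρ τ α β) *
        riemann g ginv x ![κ, ν, ρ, μ] := by
    simp_rw [← Finset.sum_neg_distrib]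
    exact Finset.sum_congr rfl fun ρ _ => Finset.sum_congr rfl fun τ _ => by
      rw [hg.sum_inv_mul_riemannUp_antisymm, neg_mul]
  have t2 : ∑ κ, ∑ τ, ginv x κ τ *
      (∑ ρ, riemannUp g ginv x ρ ν α β * riemann g ginv x ![κ, ρ, τ, μ]) =
      ∑ ρ, ricci g ginv x ![ρ, μ] * riemannUp g ginv x ρ ν α β := by
    simp_rw [hg.ricci_eq_sum, Finset.mul_sum, Finset.sum_mul]
    rw [Finset.sum_comm_cycle]
    exact Finset.sum_congr rfl fun ρ _ => Finset.sum_congr rfl fun κ _ =>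
      Finset.sum_congr rfl fun τ _ => by ring
  have t4 : ∑ κ, ∑ τ, ginv x κ τ *
      (∑ ρ, riemannUp g ginv x ρ μ α β * riemann g ginv x ![κ, ν, τ, ρ]) =
      ∑ ρ, ricci g ginv x ![ρ, ν] * riemannUp g ginv x ρ μ α β := by
    simp_rw [hg.ricci_symm x _ ν, hg.ricci_eq_sum, Finset.mul_sum, Finset.sum_mul]
    rw [Finset.sum_comm_cycle]
    exact Finset.sum_congr rfl fun ρ _ => Finset.sum_congr rfl fun κ _ =>
      Finset.sum_congr rfl fun τ _ => by ring
  rw [t1, t13, t2, t3, t4] at h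
  linarith

theorem auxRR_antisymm (x : Pt n) (μ α β γ : Fin n) :
    auxRR g ginv x μ α β γ = -auxRR g ginv x μ β α γ := by
  simp only [auxRR, ← Finset.sum_neg_distrib]
  exact Finset.sum_congr rfl fun ρ _ => by rw [riemannUp_antisymm, neg_mul]

theorem SemiSymmetric.auxRR_swap (hg : IsMetric g ginv) (hss : SemiSymmetric g ginv)
    (x : Pt n) (μ α β γ : Fin n) :
    auxRR g ginv x μ α β γ = -auxRR g ginv x γ α β μ := by
  have h := hss.curvature_ricci hg x γ μ α β
  have e : ∀ μ γ, ∑ ρ, ricci g ginv x ![ρ, γ] * riemannUp g ginv x ρ μ α β =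
      auxRR g ginv x μ α β γ := fun μ γ =>
    Finset.sum_congr rfl fun ρ _ => by rw [hg.ricci_symm x ρ γ, mul_comm]
  rw [e, e] at h
  linarith

theorem IsMetric.auxRR_cyclic (hg : IsMetric g ginv) (x : Pt n) (μ α β γ : Fin n) :
    auxRR g ginv x μ α β γ + auxRR g ginv x α β μ γ + auxRR g ginv x β μ α γ = 0 := by
  simp only [auxRR, ← Finset.sum_add_distrib, ← add_mul]
  exact Finset.sum_eq_zero fun ρ _ => by rw [hg.riemannUp_cyclic, zero_mul]

/-- The cyclic sum over `α β γ` of `R^ρ_{μαβ} R_{γρ}` vanishes. -/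
theorem SemiSymmetric.auxRR_cyclic_right (hg : IsMetric g ginv) (hss : SemiSymmetric g ginv)
    (x : Pt n) (μ α β γ : Fin n) :
    auxRR g ginv x μ α β γ + auxRR g ginv x μ β γ α + auxRR g ginv x μ γ α β = 0 := by
  rw [hss.auxRR_swap hg x μ α β γ, hss.auxRR_swap hg x μ β γ α, hss.auxRR_swap hg x μ γ α β]
  linarith [hg.auxRR_cyclic x γ α β μ]

/-- Contraction of the Weyl tensor with the Ricci tensor, expanded. -/
theorem IsMetric.auxCR_eq (hg : IsMetric g ginv) (x : Pt n) (μ α β γ : Fin n) :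
    auxCR g ginv x μ α β γ = auxRR g ginv x μ α β γ -
      (1 / ((n : ℝ) - 2)) *
        ((∑ ρ, ∑ σ, ginv x ρ σ * ricci g ginv x ![σ, α] * ricci g ginv x ![γ, ρ]) * g x β μ -
         (∑ ρ, ∑ σ, ginv x ρ σ * ricci g ginv x ![σ, β] * ricci g ginv x ![γ, ρ]) * g x α μ -
         ricci g ginv x ![μ, α] * ricci g ginv x ![γ, β] +
         ricci g ginv x ![μ, β] * ricci g ginv x ![γ, α]) +
      (scalarCurv g ginv x / (((n : ℝ) - 1) * ((n : ℝ) - 2))) *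
        (ricci g ginv x ![γ, α] * g x μ β - ricci g ginv x ![γ, β] * g x μ α) := by
  have hδ : ∀ a, ∑ ρ, ∑ σ, ginv x ρ σ * g x σ a * ricci g ginv x ![γ, ρ] =
      ricci g ginv x ![γ, a] := by
    intro a
    simp [← Finset.sum_mul, hg.2.2.2]
  rw [← hδ α, ← hδ β]
  have hR : auxRR g ginv x μ α β γ =
      ∑ ρ, ∑ σ, ginv x ρ σ * riemann g ginv x ![σ, μ, α, β] * ricci g ginv x ![γ, ρ] := by
    simp only [auxRR, hg.riemannUp_eq_sum x _ μ α β, Finset.sum_mul]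
  rw [hR]
  simp only [auxCR, Finset.sum_mul, Finset.mul_sum, ← Finset.sum_sub_distrib,
    ← Finset.sum_add_distrib]
  refine Finset.sum_congr rfl fun ρ _ => Finset.sum_congr rfl fun σ _ => ?_
  simp only [weyl, Matrix.cons_val]
  rw [hg.1 x β σ, hg.1 x α σ]
  ring

/-- `R^{ρσ} R_{ρμσν} = R_μ{}^ρ R_{ρν}` in a semi-symmetric manifold. -/
theorem SemiSymmetric.sum_ricci_mul_riemann (hg : IsMetric g ginv)
    (hss : SemiSymmetric g ginv) (x : Pt n) (μ ν : Fin n) :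
    (∑ ρ, ∑ σ, ∑ ρ', ∑ σ', ginv x ρ ρ' * ginv x σ σ' * ricci g ginv x ![ρ', σ'] *
      riemann g ginv x ![ρ, μ, σ, ν]) =
      ∑ ρ, (∑ σ, ginv x ρ σ * ricci g ginv x ![μ, σ]) * ricci g ginv x ![ρ, ν] := by
  have h : ∑ α, ∑ κ, ginv x κ α *
      ((∑ ρ, ricci g ginv x ![ρ, κ] * riemannUp g ginv x ρ μ α ν) +
        ∑ ρ, ricci g ginv x ![ρ, μ] * riemannUp g ginv x ρ κ α ν) = 0 :=
    Finset.sum_eq_zero fun α _ => Finset.sum_eq_zero fun κ _ => by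
      rw [hss.curvature_ricci hg, mul_zero]
  simp only [mul_add, Finset.sum_add_distrib] at h
  have hl : ∑ α, ∑ κ, ginv x κ α *
      (∑ ρ, ricci g ginv x ![ρ, κ] * riemannUp g ginv x ρ μ α ν) =
      ∑ ρ, ∑ σ, ∑ ρ', ∑ σ', ginv x ρ ρ' * ginv x σ σ' * ricci g ginv x ![ρ', σ'] *
        riemann g ginv x ![ρ, μ, σ, ν] := by
    rw [Finset.sum_comm (f := fun ρ σ => ∑ ρ', ∑ σ', _)]
    refine Finset.sum_congr rfl fun α _ => ?_
    rw [Finset.sum_comm_cycle]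
    refine Finset.sum_congr rfl fun κ _ => ?_
    rw [Finset.sum_comm, Finset.mul_sum]
    refine Finset.sum_congr rfl fun ρ _ => ?_
    rw [hg.riemannUp_eq_sum, Finset.mul_sum, Finset.mul_sum]
    exact Finset.sum_congr rfl fun σ _ => by
      rw [hg.inv_symm x κ α, hg.inv_symm x ρ σ]; ring
  have hr : ∑ α, ∑ κ, ginv x κ α *
      (∑ ρ, ricci g ginv x ![ρ, μ] * riemannUp g ginv x ρ κ α ν) =
      -∑ ρ, (∑ σ, ginv x ρ σ * ricci g ginv x ![μ, σ]) * ricci g ginv x ![ρ, ν] := by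
    have e : ∀ α, ∑ κ, ginv x κ α *
        (∑ ρ, ricci g ginv x ![ρ, μ] * riemannUp g ginv x ρ κ α ν) =
        -∑ κ, ∑ ρ, ginv x κ ρ * ricci g ginv x ![μ, ρ] * riemannUp g ginv x α κ α ν := by
      intro α
      calc _ = ∑ ρ, ricci g ginv x ![μ, ρ] *
            ∑ κ, ginv x κ α * riemannUp g ginv x ρ κ α ν := by
            simp_rw [Finset.mul_sum]
            rw [Finset.sum_comm]
            exact Finset.sum_congr rfl fun ρ _ => Finset.sum_congr rfl fun κ _ => by
              rw [hg.ricci_symm x ρ μ]; ring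
        _ = _ := by
            simp_rw [hg.sum_inv_mul_riemannUp_antisymm x _ α, mul_neg, Finset.sum_neg_distrib,
              Finset.mul_sum]
            rw [Finset.sum_comm]
            exact congrArg _ (Finset.sum_congr rfl fun κ _ => Finset.sum_congr rfl fun ρ _ => by
              ring)
    simp_rw [e, Finset.sum_neg_distrib]
    rw [Finset.sum_comm]
    refine congrArg _ (Finset.sum_congr rfl fun κ _ => ?_)
    simp only [ricci, Matrix.cons_val_zero, Matrix.cons_val_one, Finset.mul_sum, Finset.sum_mul]
  rw [hl, hr] at h
  linarith

/-- `R^ρ_{μ[αβ} R_{γ]ρ} = 0`, up to normalization. -/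
theorem SemiSymmetric.auxRR_antisymmetrization (hg : IsMetric g ginv)
    (hss : SemiSymmetric g ginv) (x : Pt n) (μ α β γ : Fin n) :
    auxRR g ginv x μ α β γ - auxRR g ginv x μ α γ β + auxRR g ginv x μ β γ α -
      auxRR g ginv x μ β α γ + auxRR g ginv x μ γ α β - auxRR g ginv x μ γ β α = 0 := by
  have a := auxRR_antisymm (g := g) (ginv := ginv) x μ
  linarith [hss.auxRR_cyclic_right hg x μ α β γ, a α γ β, a β α γ, a γ β α]

end Curvature

/-- In any `n`-dimensional semi-symmetric semi-Riemannian manifold of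
any signature (`n > 2`; in particular in any 2-symmetric one):
`R_{ρ(μ} R^ρ_{ν)αβ} = 0`, `R^ρ_{μ[αβ} R_{γ]ρ} = 0`, `C^ρ_{μ[αβ} R_{γ]ρ} = 0` and
`R^{ρσ} R_{ρμσν} = R_μ{}^ρ R_{ρν}`. -/
theorem stmt8 {n : ℕ} (hn : 2 < n) (g ginv : Pt n → Fin n → Fin n → ℝ)
    (hg : IsMetric g ginv) (hss : SemiSymmetric g ginv) :
    (∀ (x : Pt n) (μ ν α β : Fin n),
      ((∑ ρ, ricci g ginv x ![ρ, μ] * riemannUp g ginv x ρ ν α β) +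
       (∑ ρ, ricci g ginv x ![ρ, ν] * riemannUp g ginv x ρ μ α β)) / 2 = 0) ∧
    (∀ (x : Pt n) (μ α β γ : Fin n),
      (auxRR g ginv x μ α β γ - auxRR g ginv x μ α γ β + auxRR g ginv x μ β γ α -
       auxRR g ginv x μ β α γ + auxRR g ginv x μ γ α β - auxRR g ginv x μ γ β α) / 6 = 0) ∧
    (∀ (x : Pt n) (μ α β γ : Fin n),
      (auxCR g ginv x μ α β γ - auxCR g ginv x μ α γ β + auxCR g ginv x μ β γ α -
       auxCR g ginv x μ β α γ + auxCR g ginv x μ γ α β - auxCR g ginv x μ γ β α) / 6 = 0) ∧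
    (∀ (x : Pt n) (μ ν : Fin n),
      (∑ ρ, ∑ σ, ∑ ρ', ∑ σ', ginv x ρ ρ' * ginv x σ σ' * ricci g ginv x ![ρ', σ'] *
        riemann g ginv x ![ρ, μ, σ, ν]) =
      ∑ ρ, (∑ σ, ginv x ρ σ * ricci g ginv x ![μ, σ]) * ricci g ginv x ![ρ, ν]) := by
  refine ⟨fun x μ ν α β => ?_, fun x μ α β γ => ?_, fun x μ α β γ => ?_, fun x μ ν => ?_⟩
  · rw [hss.curvature_ricci hg, zero_div]
  · rw [hss.auxRR_antisymmetrization hg, zero_div]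
  · have hRR := hss.auxRR_antisymmetrization hg x μ α β γ
    have hS : ∀ a b, ∑ ρ, ∑ σ, ginv x ρ σ * ricci g ginv x ![σ, a] * ricci g ginv x ![b, ρ] =
        ∑ ρ, ∑ σ, ginv x ρ σ * ricci g ginv x ![σ, b] * ricci g ginv x ![a, ρ] := by
      intro a b
      rw [Finset.sum_comm]
      exact Finset.sum_congr rfl fun ρ _ => Finset.sum_congr rfl fun σ _ => by
        rw [hg.inv_symm x σ ρ, hg.ricci_symm x ρ a, hg.ricci_symm x b σ]; ring
    simp only [hg.auxCR_eq]
    rw [hS β α, hS γ α, hS γ β, hg.ricci_symm x β α, hg.ricci_symm x γ α, hg.ricci_symm x γ β,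
      hg.1 x μ α, hg.1 x μ β, hg.1 x μ γ]
    linear_combination hRR / 6
  · exact hss.sum_ricci_mul_riemann hg x μ ν
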